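/- Let d^s ≥ 1, let d_f ≥ 1, and for each a ∈ [d^s] let N_a ⊂ [d^s] be an ordered subset of d_f pixel indices with i-th element N_a(i). Then there exists a probability space carrying, for every x ∈ X, a random d^s × d^s row-stochastic matrix A(x) (each A(x) arising as the almost-sure pointwise limit of row-wise softmaxes of a family of logit matrices, as is possible under the d^{-1/2} scaling), such that for all x, x' ∈ X and all a, b, i, j ∈ [d^s]: E[A(x)_{ai} A(x')_{bj}] = 1/d_f if there exists k ∈ [d_f] with i = N_a(k) and j = N_b(k), and E[A(x)_{ai} A(x')_{bj}] = 0 otherwise. Consequently the d^{-1/2}-scaled attention NNGP kernel κ_{ab}(x,x') = Σ_{i,j} κ̃_{ij}(x,x') E[A(x)_{ai} A(x')_{bj}] can equal the convolutional kernel (1/d_f) Σ_{i=1}^{d_f} κ̃_{N_a(i) N_b(i)}(x,x') for every kernel κ̃. -/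

import Mathlib

/-!
Statement 4: Under the `d^{-1/2}` scaling, the convolutional kernel can be recovered:
there is a probability space carrying, for each input `x`, a random row-stochastic
matrix `A x` (an almost-sure pointwise limit of row-wise softmaxes of logit matrices)
whose second moments are exactly those of a convolutional filter
(Proposition `sqrt_scale_conv_recover`).
-/

open MeasureTheory Finset Filter Topology

noncomputable section

/-- Row-wise softmax of a vector of logits. -/
def softmaxRow {ds : ℕ} (v : Fin ds → ℝ) (i : Fin ds) : ℝ :=
  Real.exp (v i) / ∑ j : Fin ds, Real.exp (v j)

theorem sqrt_scaling_recovers_convolutional_kernel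
    {X : Type*} [Countable X]
    (ds df : ℕ) (hds : 1 ≤ ds) (hdf : 1 ≤ df)
    (N : Fin ds → Fin df → Fin ds) (hN : ∀ a, Function.Injective (N a)) :
    ∃ (Ω : Type) (_ : MeasurableSpace Ω) (μ : Measure Ω) (_ : IsProbabilityMeasure μ)
      (A : X → Ω → Fin ds → Fin ds → ℝ),
      -- each entry is a (measurable) random variable
      (∀ x a i, Measurable (fun ω => A x ω a i)) ∧
      -- each `A x` is row-stochastic
      (∀ x ω, (∀ a i, 0 ≤ A x ω a i) ∧ ∀ a : Fin ds, ∑ i : Fin ds, A x ω a i = 1) ∧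
      -- each `A x` arises as the almost-sure pointwise limit of row-wise softmaxes of
      -- a family of logit matrices
      (∀ x, ∃ G : ℕ → Ω → Fin ds → Fin ds → ℝ,
        ∀ᵐ ω ∂μ, ∀ (a i : Fin ds),
          Tendsto (fun n => softmaxRow (G n ω a) i) atTop (𝓝 (A x ω a i))) ∧
      -- the second moments are exactly those of the convolutional filter
      (∀ (x x' : X) (a b i j : Fin ds),
        (∫ ω, A x ω a i * A x' ω b j ∂μ)
          = if ∃ k : Fin df, i = N a k ∧ j = N b k then 1 / (df : ℝ) else 0) ∧
      -- consequently the `d^{-1/2}`-scaled attention NNGP kernel built from these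
      -- attention weights equals the convolutional kernel for every kernel `κ̃`
      (∀ (κ : X → X → Fin ds → Fin ds → ℝ) (x x' : X) (a b : Fin ds),
        (∑ i : Fin ds, ∑ j : Fin ds,
            κ x x' i j * ∫ ω, A x ω a i * A x' ω b j ∂μ)
          = (1 / (df : ℝ)) * ∑ k : Fin df, κ x x' (N a k) (N b k)) := by
  classical
  haveI : Nonempty (Fin df) := ⟨⟨0, hdf⟩⟩
  have hint : ∀ f : Fin df → ℝ,
      ∫ ω, f ω ∂((PMF.uniformOfFintype (Fin df)).toMeasure) = (1 / (df : ℝ)) * ∑ k, f k := by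
    intro f
    rw [PMF.integral_eq_sum, Finset.mul_sum]
    simp
  have hmom : ∀ a b i j : Fin ds,
      (∫ ω, (if i = N a ω then (1 : ℝ) else 0) * (if j = N b ω then (1 : ℝ) else 0)
          ∂((PMF.uniformOfFintype (Fin df)).toMeasure))
        = if ∃ k : Fin df, i = N a k ∧ j = N b k then 1 / (df : ℝ) else 0 := by
    intro a b i j
    rw [hint]
    split_ifs with h
    · obtain ⟨k, rfl, rfl⟩ := h
      rw [Finset.sum_eq_single k]
      · simp
      · intro l _ hl
        have : N a k ≠ N a l := fun e => hl (hN a e).symm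
        simp [this]
      · simp
    · rw [Finset.sum_eq_zero, mul_zero]
      intro k _
      by_cases h1 : i = N a k
      · have h2 : j ≠ N b k := fun h2 => h ⟨k, h1, h2⟩
        simp [h2]
      · simp [h1]
  refine ⟨Fin df, ⊤, (PMF.uniformOfFintype (Fin df)).toMeasure, inferInstance,
    fun _ k a i => if i = N a k then 1 else 0, ?_, ?_, ?_, ?_, ?_⟩
  · intro x a i
    exact measurable_from_top
  · intro x k
    refine ⟨fun a i => ?_, fun a => ?_⟩
    · dsimp only
      split_ifs <;> norm_num
    · simp
  · intro x
    refine ⟨fun n k a i => if i = N a k then 0 else -(n : ℝ), Eventually.of_forall ?_⟩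
    intro k a i
    have hexp : ∀ j : Fin ds, Tendsto
        (fun n : ℕ => Real.exp (if j = N a k then 0 else -(n : ℝ))) atTop
        (𝓝 (if j = N a k then 1 else 0)) := by
      intro j
      split_ifs
      · simp
      · exact Real.tendsto_exp_neg_atTop_nhds_zero.comp tendsto_natCast_atTop_atTop
    have hsum := tendsto_finsetSum (Finset.univ : Finset (Fin ds)) (fun j _ => hexp j)
    have hone : ∑ j : Fin ds, (if j = N a k then (1 : ℝ) else 0) = 1 := by simp
    rw [hone] at hsum
    have := (hexp i).div hsum one_ne_zero
    rw [div_one] at this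
    exact this
  · intro x x' a b i j
    exact hmom a b i j
  · intro κ x x' a b
    dsimp only
    simp_rw [hint, Finset.mul_sum]
    have hswap : ∀ F : Fin ds → Fin ds → Fin df → ℝ,
        ∑ i, ∑ j, ∑ k, F i j k = ∑ k, ∑ i, ∑ j, F i j k := by
      intro F
      rw [Finset.sum_comm (s := (Finset.univ : Finset (Fin df)))]
      exact Finset.sum_congr rfl fun i _ => Finset.sum_comm
    rw [hswap]
    refine Finset.sum_congr rfl fun k _ => ?_
    rw [Finset.sum_eq_single (N a k), Finset.sum_eq_single (N b k)]
    · simp [mul_comm]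
    · intro j _ hj
      simp [hj]
    · simp
    · intro i _ hi
      simp [hi]
    · simp

end
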